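/- Let Ω ⊆ ℝ^{d₀} be open and convex, and let f = α_L ∘ 𝔚_L ∘ α_{L−1} ∘ ⋯ ∘ α₁ ∘ 𝔚₁ : Ω → ℝ^{d_L}, where each 𝔚_l(x) = W_l x + w_l is affine and each α_l : ℝ^{d_l} → ℝ^{d_l} is piecewise linear with a decomposition whose piece matrices T^{l,i} all satisfy the entrywise bound |(T^{l,i})_{mn}| ≤ (B_l)_{mn} for a fixed nonnegative matrix B_l. Then for all 1 ≤ p, q ≤ ∞, L_{p→q}(f, Ω) ≤ ‖ B_L |W_L| B_{L−1} |W_{L−1}| ⋯ B₁ |W₁| ‖_{p→q}, where |W| denotes the entrywise absolute value of W. -/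

import Mathlib

open scoped ENNReal BigOperators

/-- The ℓ^p norm on `ℝ^n`, for `p : ℝ≥0∞` (with `p = ∞` giving the max norm). -/
noncomputable def lpNorm (p : ℝ≥0∞) {n : ℕ} (x : Fin n → ℝ) : ℝ :=
  if p = ⊤ then ⨆ i, |x i| else (∑ i, |x i| ^ p.toReal) ^ (1 / p.toReal)

/-- The induced `(p → q)` operator norm of a matrix: `sup_{x ≠ 0} ‖Tx‖_q / ‖x‖_p`. -/
noncomputable def opNorm (p q : ℝ≥0∞) {m n : ℕ} (T : Matrix (Fin m) (Fin n) ℝ) : ℝ :=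
  ⨆ x : {x : Fin n → ℝ // x ≠ 0}, lpNorm q (T.mulVec x.1) / lpNorm p x.1

/-- The `(p → q)` Lipschitz norm of `f` over `Ω`:
`sup_{x ≠ y ∈ Ω} ‖f x − f y‖_q / ‖x − y‖_p`. -/
noncomputable def lipNorm (p q : ℝ≥0∞) {n m : ℕ}
    (f : (Fin n → ℝ) → (Fin m → ℝ)) (Ω : Set (Fin n → ℝ)) : ℝ :=
  sSup {r | ∃ x ∈ Ω, ∃ y ∈ Ω, x ≠ y ∧ r = lpNorm q (f x - f y) / lpNorm p (x - y)}

/-- A polyhedron in `ℝ^n`: a set of the form `{x : A x ≤ b}` (componentwise). -/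
def IsPolyhedron {n : ℕ} (P : Set (Fin n → ℝ)) : Prop :=
  ∃ (r : ℕ) (A : Matrix (Fin r) (Fin n) ℝ) (b : Fin r → ℝ),
    P = {x | ∀ i, A.mulVec x i ≤ b i}

/-- The neural network `α_L ∘ 𝔚_L ∘ ⋯ ∘ α₁ ∘ 𝔚₁` with affine layers
`𝔚_{l+1} x = W l * x + w l` and activations `α_{l+1} = a l`. -/
noncomputable def network (d : ℕ → ℕ)
    (W : ∀ l : ℕ, Matrix (Fin (d (l + 1))) (Fin (d l)) ℝ)
    (w : ∀ l : ℕ, Fin (d (l + 1)) → ℝ)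
    (a : ∀ l : ℕ, (Fin (d (l + 1)) → ℝ) → (Fin (d (l + 1)) → ℝ)) :
    (L : ℕ) → (Fin (d 0) → ℝ) → (Fin (d L) → ℝ)
  | 0 => id
  | (L + 1) => fun x => a L ((W L).mulVec (network d W w a L x) + w L)

/-- The matrix product `B_L |W_L| B_{L-1} |W_{L-1}| ⋯ B₁ |W₁|`, where `|W|` is the
entrywise absolute value. -/
noncomputable def networkBoundProd (d : ℕ → ℕ)
    (W : ∀ l : ℕ, Matrix (Fin (d (l + 1))) (Fin (d l)) ℝ)
    (B : ∀ l : ℕ, Matrix (Fin (d (l + 1))) (Fin (d (l + 1))) ℝ) :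
    (L : ℕ) → Matrix (Fin (d L)) (Fin (d 0)) ℝ
  | 0 => 1
  | (L + 1) => B L * (W L).map (fun r => |r|) * networkBoundProd d W B L

lemma lpNorm_nonneg (p : ℝ≥0∞) {n : ℕ} (x : Fin n → ℝ) : 0 ≤ lpNorm p x := by
  unfold lpNorm
  split_ifs
  · exact Real.iSup_nonneg fun i => abs_nonneg _
  · positivity

lemma lpNorm_mono (p : ℝ≥0∞) {n : ℕ} {x y : Fin n → ℝ} (h : ∀ i, |x i| ≤ |y i|) :
    lpNorm p x ≤ lpNorm p y := by
  unfold lpNorm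
  split_ifs
  · exact ciSup_mono (Set.finite_range _).bddAbove h
  · refine Real.rpow_le_rpow (by positivity) (Finset.sum_le_sum fun i _ => ?_) (by positivity)
    exact Real.rpow_le_rpow (abs_nonneg _) (h i) ENNReal.toReal_nonneg

lemma lpNorm_abs (p : ℝ≥0∞) {n : ℕ} (x : Fin n → ℝ) :
    lpNorm p (fun i => |x i|) = lpNorm p x := by
  simp [lpNorm]

lemma abs_apply_le_lpNorm {p : ℝ≥0∞} (hp : 1 ≤ p) {n : ℕ} (x : Fin n → ℝ) (i : Fin n) :
    |x i| ≤ lpNorm p x := by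
  unfold lpNorm
  split_ifs with h
  · exact le_ciSup (f := fun i => |x i|) (Set.finite_range _).bddAbove i
  · have hp0 : 0 < p.toReal := ENNReal.toReal_pos (zero_lt_one.trans_le hp).ne' h
    calc |x i| = (|x i| ^ p.toReal) ^ (1 / p.toReal) := by
          rw [one_div, Real.rpow_rpow_inv (abs_nonneg _) hp0.ne']
      _ ≤ _ := by
          gcongr
          exact Finset.single_le_sum (f := fun i => |x i| ^ p.toReal)
            (fun j _ => by positivity) (Finset.mem_univ i)

lemma lpNorm_smul {p : ℝ≥0∞} (hp : 1 ≤ p) {n : ℕ} {c : ℝ} (hc : 0 ≤ c) (x : Fin n → ℝ) :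
    lpNorm p (c • x) = c * lpNorm p x := by
  unfold lpNorm
  split_ifs with h
  · simp [abs_mul, abs_of_nonneg hc, Real.mul_iSup_of_nonneg hc]
  · have hp0 : 0 < p.toReal := ENNReal.toReal_pos (zero_lt_one.trans_le hp).ne' h
    simp only [Pi.smul_apply, smul_eq_mul, abs_mul, abs_of_nonneg hc,
      Real.mul_rpow hc (abs_nonneg _), ← Finset.mul_sum]
    rw [Real.mul_rpow (by positivity) (by positivity), one_div,
      Real.rpow_rpow_inv hc hp0.ne']

lemma lpNorm_pos {p : ℝ≥0∞} (hp : 1 ≤ p) {n : ℕ} {x : Fin n → ℝ} (hx : x ≠ 0) :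
    0 < lpNorm p x := by
  obtain ⟨i, hi⟩ := Function.ne_iff.mp hx
  exact (abs_pos.mpr hi).trans_le (abs_apply_le_lpNorm hp x i)

lemma opNorm_nonneg (p q : ℝ≥0∞) {m n : ℕ} (T : Matrix (Fin m) (Fin n) ℝ) :
    0 ≤ opNorm p q T :=
  Real.iSup_nonneg fun _ => div_nonneg (lpNorm_nonneg _ _) (lpNorm_nonneg _ _)

lemma abs_mulVec_le {m n : ℕ} {T B : Matrix (Fin m) (Fin n) ℝ} (h : ∀ i j, |T i j| ≤ B i j)
    {x z : Fin n → ℝ} (hz : ∀ j, |x j| ≤ z j) (i : Fin m) :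
    |T.mulVec x i| ≤ B.mulVec z i := by
  simp only [Matrix.mulVec, dotProduct]
  refine (Finset.abs_sum_le_sum_abs _ _).trans (Finset.sum_le_sum fun j _ => ?_)
  rw [abs_mul]
  exact mul_le_mul (h i j) (hz j) (abs_nonneg _) ((abs_nonneg _).trans (h i j))

/-- The supremum defining the operator norm is over a bounded set. -/
lemma bddAbove_lpNorm_mulVec_div {p q : ℝ≥0∞} (hp : 1 ≤ p) (hq : 1 ≤ q) {m n : ℕ}
    (T : Matrix (Fin m) (Fin n) ℝ) :
    BddAbove (Set.range fun x : {x : Fin n → ℝ // x ≠ 0} =>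
      lpNorm q (T.mulVec x.1) / lpNorm p x.1) := by
  refine ⟨lpNorm q ((T.map fun r => |r|).mulVec 1), ?_⟩
  rintro _ ⟨⟨x, hx⟩, rfl⟩
  rw [div_le_iff₀ (lpNorm_pos hp hx), mul_comm, ← lpNorm_smul hq (lpNorm_nonneg p x),
    ← Matrix.mulVec_smul]
  refine lpNorm_mono q fun i => (abs_mulVec_le (fun _ _ => le_rfl) (fun j => ?_) i).trans
    (le_abs_self _)
  simpa using abs_apply_le_lpNorm hp x j

lemma lpNorm_mulVec_le {p q : ℝ≥0∞} (hp : 1 ≤ p) (hq : 1 ≤ q) {m n : ℕ}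
    (T : Matrix (Fin m) (Fin n) ℝ) {x : Fin n → ℝ} (hx : x ≠ 0) :
    lpNorm q (T.mulVec x) / lpNorm p x ≤ opNorm p q T :=
  le_ciSup (bddAbove_lpNorm_mulVec_div hp hq T) ⟨x, hx⟩

lemma IsPolyhedron.isClosed {n : ℕ} {P : Set (Fin n → ℝ)} (h : IsPolyhedron P) :
    IsClosed P := by
  obtain ⟨r, A, b, rfl⟩ := h
  simp only [Set.ofPred_forall]
  exact isClosed_iInter fun i => isClosed_le
    ((continuous_apply i).comp (Continuous.matrix_mulVec continuous_const continuous_id))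
    continuous_const

/-- A real function that is `C`-Lipschitz on each of finitely many closed sets covering an
interval is `C`-Lipschitz between the endpoints of that interval. -/
lemma abs_sub_le_of_closed_cover {ι : Type*} {S : ι → Set ℝ} (hS : ∀ j, IsClosed (S j))
    {h : ℝ → ℝ} {C : ℝ} (hC : ∀ j, ∀ s ∈ S j, ∀ t ∈ S j, |h t - h s| ≤ C * |t - s|)
    (F : Finset ι) {s t : ℝ} (hst : s ≤ t) (hcov : Set.Icc s t ⊆ ⋃ j ∈ F, S j) :
    |h t - h s| ≤ C * (t - s) := by
  classical
  induction F using Finset.strongInduction generalizing s with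
  | H F ih =>
    obtain ⟨j, hjF, hsj⟩ : ∃ j ∈ F, s ∈ S j := by
      simpa using hcov (Set.left_mem_Icc.mpr hst)
    have hK : IsCompact (Set.Icc s t ∩ S j) := isCompact_Icc.inter_right (hS j)
    obtain ⟨u, ⟨⟨hsu, hut⟩, huj⟩, hmax⟩ :=
      hK.exists_isGreatest ⟨s, Set.left_mem_Icc.mpr hst, hsj⟩
    have h_left : |h u - h s| ≤ C * (u - s) := by
      simpa [abs_of_nonneg (sub_nonneg.mpr hsu)] using hC j s hsj u huj
    rcases hut.eq_or_lt with rfl | hlt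
    · exact h_left
    have hIoc : Set.Ioc u t ⊆ ⋃ i ∈ F.erase j, S i := by
      intro v hv
      obtain ⟨i, hiF, hvi⟩ : ∃ i ∈ F, v ∈ S i := by
        simpa using hcov ⟨hsu.trans hv.1.le, hv.2⟩
      have hij : i ≠ j := by
        rintro rfl
        exact (hmax ⟨⟨hsu.trans hv.1.le, hv.2⟩, hvi⟩).not_gt hv.1
      simpa using ⟨i, ⟨hij, hiF⟩, hvi⟩
    have hIcc : Set.Icc u t ⊆ ⋃ i ∈ F.erase j, S i := by
      rw [← closure_Ioc hlt.ne]
      exact closure_minimal hIoc (isClosed_biUnion_finset fun i _ => hS i)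
    have h_right := ih _ (Finset.erase_ssubset hjF) hut hIcc
    calc |h t - h s| ≤ |h t - h u| + |h u - h s| := abs_sub_le _ _ _
      _ ≤ C * (t - u) + C * (u - s) := add_le_add h_right h_left
      _ = C * (t - s) := by ring

/-- A map that is affine on each of finitely many closed sets covering the space, with matrices
entrywise dominated by `B`, satisfies the corresponding componentwise Lipschitz bound. -/
lemma abs_sub_le_mulVec_of_piecewise {n m : ℕ} {ι : Type*} [Fintype ι]
    {P : ι → Set (Fin n → ℝ)} (hP : ∀ j, IsClosed (P j)) (hcov : ⋃ j, P j = Set.univ)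
    {T : ι → Matrix (Fin m) (Fin n) ℝ} {t : ι → Fin m → ℝ} {a : (Fin n → ℝ) → (Fin m → ℝ)}
    (ha : ∀ j, ∀ x ∈ P j, a x = (T j).mulVec x + t j)
    {B : Matrix (Fin m) (Fin n) ℝ} (hT : ∀ j k l, |T j k l| ≤ B k l)
    (x y : Fin n → ℝ) (i : Fin m) :
    |a x i - a y i| ≤ B.mulVec (fun k => |x k - y k|) i := by
  have hline : Continuous fun s : ℝ => y + s • (x - y) := by fun_prop
  have key := abs_sub_le_of_closed_cover (S := fun j => (fun s : ℝ => y + s • (x - y)) ⁻¹' P j)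
    (fun j => (hP j).preimage hline) (h := fun s => a (y + s • (x - y)) i)
    (C := B.mulVec (fun k => |x k - y k|) i) ?_ Finset.univ zero_le_one ?_
  · simpa using key
  · intro j s hs t ht
    have hdiff : a (y + t • (x - y)) i - a (y + s • (x - y)) i
        = (t - s) * (T j).mulVec (x - y) i := by
      rw [ha j _ hs, ha j _ ht]
      simp only [Matrix.mulVec_add, Matrix.mulVec_smul, Pi.add_apply, Pi.smul_apply, smul_eq_mul]
      ring
    simp only [hdiff, abs_mul]
    rw [mul_comm]
    gcongr
    exact abs_mulVec_le (hT j) (fun _ => le_rfl) i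
  · intro s _
    have : y + s • (x - y) ∈ ⋃ j, P j := hcov ▸ Set.mem_univ _
    simpa using this

lemma abs_network_sub_le {d : ℕ → ℕ}
    {W : ∀ l : ℕ, Matrix (Fin (d (l + 1))) (Fin (d l)) ℝ}
    {w : ∀ l : ℕ, Fin (d (l + 1)) → ℝ}
    {a : ∀ l : ℕ, (Fin (d (l + 1)) → ℝ) → (Fin (d (l + 1)) → ℝ)}
    {B : ∀ l : ℕ, Matrix (Fin (d (l + 1))) (Fin (d (l + 1))) ℝ}
    (hB : ∀ l i j, 0 ≤ B l i j)
    (ha : ∀ l x y i, |a l x i - a l y i| ≤ (B l).mulVec (fun k => |x k - y k|) i)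
    (L : ℕ) (x y : Fin (d 0) → ℝ) (i : Fin (d L)) :
    |network d W w a L x i - network d W w a L y i|
      ≤ (networkBoundProd d W B L).mulVec (fun k => |x k - y k|) i := by
  induction L with
  | zero => simp [network, networkBoundProd]
  | succ L ih =>
    simp only [network, networkBoundProd, ← Matrix.mulVec_mulVec]
    refine (ha L _ _ i).trans ((le_abs_self _).trans
      (abs_mulVec_le (fun k l => (abs_of_nonneg (hB L k l)).le) (fun k => ?_) i))
    rw [abs_abs, Pi.add_apply, Pi.add_apply, add_sub_add_right_eq_sub, ← Pi.sub_apply,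
      ← Matrix.mulVec_sub]
    exact abs_mulVec_le (fun _ _ => le_rfl) ih k

/-- Let `Ω ⊆ ℝ^{d 0}` be open and convex and let
`f = α_L ∘ 𝔚_L ∘ ⋯ ∘ α₁ ∘ 𝔚₁`, where each activation `α_l` is piecewise linear with
all piece matrices entrywise dominated (in absolute value) by a fixed nonnegative
matrix `B l`. Then for all `1 ≤ p, q ≤ ∞`,
`L_{p→q}(f, Ω) ≤ ‖B_L |W_L| ⋯ B₁ |W₁|‖_{p→q}`. -/
theorem network_lipNorm_le (d : ℕ → ℕ) (L : ℕ)
    (Ω : Set (Fin (d 0) → ℝ)) (hΩopen : IsOpen Ω) (hΩconv : Convex ℝ Ω)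
    (W : ∀ l : ℕ, Matrix (Fin (d (l + 1))) (Fin (d l)) ℝ)
    (w : ∀ l : ℕ, Fin (d (l + 1)) → ℝ)
    (a : ∀ l : ℕ, (Fin (d (l + 1)) → ℝ) → (Fin (d (l + 1)) → ℝ))
    (B : ∀ l : ℕ, Matrix (Fin (d (l + 1))) (Fin (d (l + 1))) ℝ)
    (hB : ∀ l i j, 0 ≤ B l i j)
    (ha : ∀ l : ℕ, ∃ (k : ℕ) (P : Fin k → Set (Fin (d (l + 1)) → ℝ))
      (T : Fin k → Matrix (Fin (d (l + 1))) (Fin (d (l + 1))) ℝ)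
      (t : Fin k → Fin (d (l + 1)) → ℝ),
      (∀ i, IsPolyhedron (P i)) ∧
      (∀ i, (interior (P i)).Nonempty) ∧
      (∀ i j, i ≠ j → interior (P i) ∩ interior (P j) = ∅) ∧
      (⋃ i, P i) = Set.univ ∧
      (∀ i, ∀ x ∈ P i, a l x = (T i).mulVec x + t i) ∧
      (∀ i m n, |T i m n| ≤ B l m n))
    (p q : ℝ≥0∞) (hp : 1 ≤ p) (hq : 1 ≤ q) :
    lipNorm p q (network d W w a L) Ω ≤ opNorm p q (networkBoundProd d W B L) := by
  have hnet := abs_network_sub_le (W := W) (w := w) hB (a := a) fun l x y i => by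
    obtain ⟨k, P, T, t, hP, -, -, hcov, haff, hT⟩ := ha l
    exact abs_sub_le_mulVec_of_piecewise (fun j => (hP j).isClosed) hcov haff hT x y i
  refine Real.sSup_le ?_ (opNorm_nonneg _ _ _)
  rintro _ ⟨x, -, y, -, hxy, rfl⟩
  have hne : (fun k => |(x - y) k|) ≠ 0 := fun h =>
    hxy (sub_eq_zero.mp (funext fun k => abs_eq_zero.mp (congrFun h k)))
  refine le_trans ?_ (lpNorm_mulVec_le hp hq _ hne)
  rw [lpNorm_abs]
  exact div_le_div_of_nonneg_right
    (lpNorm_mono q fun i => (hnet L x y i).trans (le_abs_self _)) (lpNorm_nonneg _ _)
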